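/- Let k be a commutative ring, Ω a nonempty set, (F, (κ_ω)_{ω∈Ω}) a commutative matching Rota-Baxter k-algebra of weight zero, and A a commutative augmented k-algebra (so A = k ⊕ A⁺ as a unitization of a nonunital algebra A⁺). Then there exists a free commutative (F, κ_Ω)-matching Rota-Baxter algebra of weight zero on A; that is, there exist a commutative k-algebra G with a family (P_ω)_{ω∈Ω} of k-linear operators satisfying the weight-zero matching Rota-Baxter equation, an algebra homomorphism i : F → G with i ∘ κ_ω = P_ω ∘ i for all ω, and an algebra homomorphism j : A → G, such that for every commutative k-algebra R with a family (Q_ω)_{ω∈Ω} satisfying the weight-zero matching Rota-Baxter equation, every algebra homomorphism i_R : F → R with i_R ∘ κ_ω = Q_ω ∘ i_R for all ω, and every algebra homomorphism f : A → R, there is a unique algebra homomorphism f̄ : G → R with f̄ ∘ P_ω = Q_ω ∘ f̄ for all ω ∈ Ω, f̄ ∘ i = i_R, and f̄ ∘ j = f. -/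

import Mathlib

universe u v w w' x

/-- A commutative matching Rota-Baxter algebra of weight zero over `k` with operator
set `Ω`. -/
structure CommMatchingRB (k : Type u) [CommRing k] (Ω : Type v) :
    Type (max u v (w + 1)) where
  carrier : Type w
  [instCommRing : CommRing carrier]
  [instAlgebra : Algebra k carrier]
  P : Ω → carrier →ₗ[k] carrier
  rb : ∀ (α β : Ω) (a b : carrier),
    P α a * P β b = P α (a * P β b) + P β (P α a * b)

attribute [instance] CommMatchingRB.instCommRing CommMatchingRB.instAlgebra

namespace FreeRB

section
variable (k : Type u) [CommRing k] (Ω : Type v)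
    (F : Type w) [CommRing F] [Algebra k F] (κ : Ω → F →ₗ[k] F)
    (A : Type w') [CommRing A] [Algebra k A]

/-- Formal terms. -/
inductive Term : Type (max v w w') where
  | ofF : F → Term
  | ofA : A → Term
  | add : Term → Term → Term
  | mul : Term → Term → Term
  | op : Ω → Term → Term

open Term

variable {Ω F A}

/-- The relations defining the free object. -/
inductive Rel : Term Ω F A → Term Ω F A → Prop where
  | add_l (a b c) : Rel a b → Rel (add a c) (add b c)
  | add_r (a b c) : Rel a b → Rel (add c a) (add c b)
  | mul_l (a b c) : Rel a b → Rel (mul a c) (mul b c)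
  | mul_r (a b c) : Rel a b → Rel (mul c a) (mul c b)
  | op_c (ω a b) : Rel a b → Rel (op ω a) (op ω b)
  | add_assoc (a b c) : Rel (add (add a b) c) (add a (add b c))
  | add_comm (a b) : Rel (add a b) (add b a)
  | zero_add (a) : Rel (add (ofF 0) a) a
  | neg_add (a) : Rel (add (mul (ofF (-1)) a) a) (ofF 0)
  | mul_assoc (a b c) : Rel (mul (mul a b) c) (mul a (mul b c))
  | mul_comm (a b) : Rel (mul a b) (mul b a)
  | one_mul (a) : Rel (mul (ofF 1) a) a
  | zero_mul (a) : Rel (mul (ofF 0) a) (ofF 0)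
  | mul_add (a b c) : Rel (mul a (add b c)) (add (mul a b) (mul a c))
  | F_add (x y) : Rel (ofF (x + y)) (add (ofF x) (ofF y))
  | F_mul (x y) : Rel (ofF (x * y)) (mul (ofF x) (ofF y))
  | A_add (x y) : Rel (ofA (x + y)) (add (ofA x) (ofA y))
  | A_mul (x y) : Rel (ofA (x * y)) (mul (ofA x) (ofA y))
  | A_alg (r : k) : Rel (ofA (algebraMap k A r)) (ofF (algebraMap k F r))
  | op_add (ω a b) : Rel (op ω (add a b)) (add (op ω a) (op ω b))
  | op_smul (ω) (r : k) (a) :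
      Rel (op ω (mul (ofF (algebraMap k F r)) a)) (mul (ofF (algebraMap k F r)) (op ω a))
  | op_F (ω c) : Rel (ofF (κ ω c)) (op ω (ofF c))
  | rb (α β a b) : Rel (mul (op α a) (op β b))
      (add (op α (mul a (op β b))) (op β (mul (op α a) b)))

variable (A)

/-- The carrier of the free object. -/
def Free : Type (max v w w') := Quot (Rel k κ (A := A))

namespace Free

/-- Quotient map. -/
def mk (t : Term Ω F A) : Free k κ A := Quot.mk _ t

instance : Add (Free k κ A) :=
  ⟨Quot.map₂ add (fun c a b h => Rel.add_r a b c h) (fun a b c h => Rel.add_l a b c h)⟩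
instance : Mul (Free k κ A) :=
  ⟨Quot.map₂ mul (fun c a b h => Rel.mul_r a b c h) (fun a b c h => Rel.mul_l a b c h)⟩
instance : Zero (Free k κ A) := ⟨mk k κ A (ofF 0)⟩
instance : One (Free k κ A) := ⟨mk k κ A (ofF 1)⟩
instance : Neg (Free k κ A) := ⟨fun a => mk k κ A (ofF (-1)) * a⟩

theorem add_comm' (a b : Free k κ A) : a + b = b + a := by
  induction a using Quot.ind; induction b using Quot.ind
  exact Quot.sound (Rel.add_comm _ _)
theorem mul_comm' (a b : Free k κ A) : a * b = b * a := by
  induction a using Quot.ind; induction b using Quot.ind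
  exact Quot.sound (Rel.mul_comm _ _)
theorem zero_add' (a : Free k κ A) : 0 + a = a := by
  induction a using Quot.ind
  exact Quot.sound (Rel.zero_add _)
theorem one_mul' (a : Free k κ A) : 1 * a = a := by
  induction a using Quot.ind
  exact Quot.sound (Rel.one_mul _)
theorem zero_mul' (a : Free k κ A) : 0 * a = 0 := by
  induction a using Quot.ind
  exact Quot.sound (Rel.zero_mul _)
theorem mul_add' (a b c : Free k κ A) : a * (b + c) = a * b + a * c := by
  induction a using Quot.ind; induction b using Quot.ind; induction c using Quot.ind
  exact Quot.sound (Rel.mul_add _ _ _)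

instance : CommRing (Free k κ A) where
  add_assoc a b c := by
    induction a using Quot.ind; induction b using Quot.ind; induction c using Quot.ind
    exact Quot.sound (Rel.add_assoc _ _ _)
  add_comm := add_comm' k κ A
  zero_add := zero_add' k κ A
  add_zero a := by rw [add_comm', zero_add']
  mul_assoc a b c := by
    induction a using Quot.ind; induction b using Quot.ind; induction c using Quot.ind
    exact Quot.sound (Rel.mul_assoc _ _ _)
  mul_comm := mul_comm' k κ A
  one_mul := one_mul' k κ A
  mul_one a := by rw [mul_comm', one_mul']
  zero_mul := zero_mul' k κ A
  mul_zero a := by rw [mul_comm', zero_mul']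
  left_distrib := mul_add' k κ A
  right_distrib a b c := by
    rw [mul_comm', mul_add', mul_comm' k κ A c a, mul_comm' k κ A c b]
  neg_add_cancel a := by
    induction a using Quot.ind
    exact Quot.sound (Rel.neg_add _)
  nsmul := nsmulRec
  zsmul := zsmulRec

/-- The structure map as a ring homomorphism. -/
def iRing : F →+* Free k κ A where
  toFun c := mk k κ A (ofF c)
  map_one' := rfl
  map_zero' := rfl
  map_add' x y := Quot.sound (Rel.F_add x y)
  map_mul' x y := Quot.sound (Rel.F_mul x y)

instance : Algebra k (Free k κ A) := ((iRing k κ A).comp (algebraMap k F)).toAlgebra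

/-- The structure map. -/
def iHom : F →ₐ[k] Free k κ A := { iRing k κ A with commutes' := fun _ => rfl }

/-- The map from `A`. -/
def jHom : A →ₐ[k] Free k κ A where
  toFun a := mk k κ A (ofA a)
  map_one' := by
    have h := Quot.sound (Rel.A_alg (κ := κ) (A := A) (1 : k))
    rw [map_one, map_one] at h
    exact h
  map_zero' := by
    have h := Quot.sound (Rel.A_alg (κ := κ) (A := A) (0 : k))
    rw [map_zero, map_zero] at h
    exact h
  map_add' x y := Quot.sound (Rel.A_add x y)
  map_mul' x y := Quot.sound (Rel.A_mul x y)
  commutes' r := Quot.sound (Rel.A_alg r)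

/-- The operators. -/
def P (ω : Ω) : Free k κ A →ₗ[k] Free k κ A where
  toFun := Quot.map (op ω) (fun a b h => Rel.op_c ω a b h)
  map_add' a b := by
    induction a using Quot.ind; induction b using Quot.ind
    exact Quot.sound (Rel.op_add _ _ _)
  map_smul' r a := by
    have e : ∀ b : Free k κ A, r • b = mk k κ A (ofF (algebraMap k F r)) * b :=
      fun b => Algebra.smul_def r b
    refine Eq.trans (congrArg _ (e a)) (Eq.trans ?_ (e _).symm)
    induction a using Quot.ind
    exact Quot.sound (Rel.op_smul _ _ _)

/-- The free object. -/
def obj : CommMatchingRB.{u, v, max v w w'} k Ω where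
  carrier := Free k κ A
  P := P k κ A
  rb α β a b := by
    induction a using Quot.ind; induction b using Quot.ind
    exact Quot.sound (Rel.rb _ _ _ _)

variable {k A} {R : CommMatchingRB.{u, v, x} k Ω} (iR : F →ₐ[k] R.carrier)
  (f : A →ₐ[k] R.carrier)

/-- Evaluation of terms. -/
def eval : Term Ω F A → R.carrier
  | ofF c => iR c
  | ofA a => f a
  | add s t => eval s + eval t
  | mul s t => eval s * eval t
  | op ω t => R.P ω (eval t)

variable {κ}

theorem eval_rel (h : ∀ (ω : Ω) (c : F), iR (κ ω c) = R.P ω (iR c)) {s t : Term Ω F A}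
    (r : Rel k κ s t) : eval iR f s = eval iR f t := by
  induction r with
  | add_l a b c _ ih => simp only [eval, ih]
  | add_r a b c _ ih => simp only [eval, ih]
  | mul_l a b c _ ih => simp only [eval, ih]
  | mul_r a b c _ ih => simp only [eval, ih]
  | op_c ω a b _ ih => simp only [eval, ih]
  | add_assoc a b c => simp only [eval]; ring
  | add_comm a b => simp only [eval]; ring
  | zero_add a => simp [eval]
  | neg_add a => simp [eval]
  | mul_assoc a b c => simp only [eval]; ring
  | mul_comm a b => simp only [eval]; ring
  | one_mul a => simp [eval]
  | zero_mul a => simp [eval]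
  | mul_add a b c => simp only [eval]; ring
  | F_add a b => simp [eval]
  | F_mul a b => simp [eval]
  | A_add a b => simp [eval]
  | A_mul a b => simp [eval]
  | A_alg r => simp only [eval, AlgHom.commutes]
  | op_add ω a b => simp [eval]
  | op_smul ω r a => simp only [eval, AlgHom.commutes, ← Algebra.smul_def, map_smul]
  | op_F ω c => simp only [eval, h]
  | rb α β a b => simp only [eval]; exact R.rb _ _ _ _

/-- The induced homomorphism. -/
def lift (h : ∀ (ω : Ω) (c : F), iR (κ ω c) = R.P ω (iR c)) : Free k κ A →ₐ[k] R.carrier where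
  toFun := Quot.lift (eval iR f) (fun _ _ r => eval_rel iR f h r)
  map_one' := map_one iR
  map_zero' := map_zero iR
  map_add' a b := by
    induction a using Quot.ind; induction b using Quot.ind
    rfl
  map_mul' a b := by
    induction a using Quot.ind; induction b using Quot.ind
    rfl
  commutes' r := iR.commutes r

theorem exists_free : ∃ (G : CommMatchingRB.{u, v, max v w w'} k Ω)
      (i : F →ₐ[k] G.carrier) (j : A →ₐ[k] G.carrier),
      (∀ (ω : Ω) (c : F), i (κ ω c) = G.P ω (i c)) ∧
      ∀ (R : CommMatchingRB.{u, v, x} k Ω) (iR : F →ₐ[k] R.carrier),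
        (∀ (ω : Ω) (c : F), iR (κ ω c) = R.P ω (iR c)) →
        ∀ f : A →ₐ[k] R.carrier,
          ∃! g : G.carrier →ₐ[k] R.carrier,
            (∀ (ω : Ω) (z : G.carrier), g (G.P ω z) = R.P ω (g z)) ∧
            (∀ c : F, g (i c) = iR c) ∧
            ∀ a : A, g (j a) = f a := by
  refine ⟨obj k κ A, iHom k κ A, jHom k κ A, fun ω c => Quot.sound (Rel.op_F ω c), ?_⟩
  intro R iR h f
  refine ⟨lift iR f h, ⟨?_, fun _ => rfl, fun _ => rfl⟩, ?_⟩
  · intro ω z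
    induction z using Quot.ind
    rfl
  · rintro g ⟨h1, h2, h3⟩
    have key : ∀ t : Term Ω F A, g (mk k κ A t) = eval iR f t := by
      intro t
      induction t with
      | ofF c => exact h2 c
      | ofA a => exact h3 a
      | add s t hs ht =>
        exact (map_add g (mk k κ A s) (mk k κ A t)).trans (congrArg₂ (· + ·) hs ht)
      | mul s t hs ht =>
        exact (map_mul g (mk k κ A s) (mk k κ A t)).trans (congrArg₂ (· * ·) hs ht)
      | op ω t ht => exact (h1 ω (mk k κ A t)).trans (by rw [ht]; rfl)
    apply AlgHom.ext
    intro z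
    induction z using Quot.ind
    exact key _

end Free
end
end FreeRB

/-- Existence of the free commutative `(F, κ_Ω)`-matching Rota-Baxter algebra of weight
zero on a commutative augmented algebra `A = Unitization k A⁺`. -/
theorem free_relative_comm_matching_rb
    (k : Type u) [CommRing k] (Ω : Type v) [Nonempty Ω]
    (F : Type w) [CommRing F] [Algebra k F] (κ : Ω → F →ₗ[k] F)
    (hκ : ∀ (α β : Ω) (x y : F),
      κ α x * κ β y = κ α (x * κ β y) + κ β (κ α x * y))
    (A' : Type w') [NonUnitalCommRing A'] [Module k A']
    [IsScalarTower k A' A'] [SMulCommClass k A' A'] :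
    ∃ (G : CommMatchingRB.{u, v, max u v w w'} k Ω)
      (i : F →ₐ[k] G.carrier) (j : Unitization k A' →ₐ[k] G.carrier),
      (∀ (ω : Ω) (c : F), i (κ ω c) = G.P ω (i c)) ∧
      ∀ (R : CommMatchingRB.{u, v, x} k Ω) (iR : F →ₐ[k] R.carrier),
        (∀ (ω : Ω) (c : F), iR (κ ω c) = R.P ω (iR c)) →
        ∀ f : Unitization k A' →ₐ[k] R.carrier,
          ∃! g : G.carrier →ₐ[k] R.carrier,
            (∀ (ω : Ω) (z : G.carrier), g (G.P ω z) = R.P ω (g z)) ∧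
            (∀ c : F, g (i c) = iR c) ∧
            ∀ a : Unitization k A', g (j a) = f a := by
  exact FreeRB.Free.exists_free (κ := κ) (A := Unitization k A')
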